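/- arXiv:2112.10445 — 6 statements merged into one kernel-verified Lean document; each statement's English description precedes it below -/
import Mathlib

section
/- For every claim-augmented argumentation framework F, the inherited naive semantics and the claim-level naive semantics coincide, i.e. na_c(F) = cl-naive(F), if and only if the family na_c(F) is incomparable (no member is a strict subset of another). -/
/-- A set `E` of arguments is conflict-free w.r.t. attack relation `R`:
no argument in `E` attacks another argument in `E`. -/
def ConflictFree {α : Type*} (R : α → α → Prop) (E : Set α) : Prop :=
  ∀ a ∈ E, ∀ b ∈ E, ¬ R a b

/-- A set `E` is naive iff it is ⊆-maximal among conflict-free sets. -/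
def Naive {α : Type*} (R : α → α → Prop) (E : Set α) : Prop :=
  ConflictFree R E ∧ ∀ E', ConflictFree R E' → E ⊆ E' → E' = E

/-- Inherited naive semantics: claim-sets of naive extensions. -/
def naC {α γ : Type*} (R : α → α → Prop) (cl : α → γ) : Set (Set γ) :=
  {S | ∃ E, Naive R E ∧ S = cl '' E}

/-- Claim-sets of conflict-free sets. -/
def cfC {α γ : Type*} (R : α → α → Prop) (cl : α → γ) : Set (Set γ) :=
  {S | ∃ E, ConflictFree R E ∧ S = cl '' E}

/-- Claim-level naive semantics: ⊆-maximal claim-sets of conflict-free sets. -/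
def clNaive {α γ : Type*} (R : α → α → Prop) (cl : α → γ) : Set (Set γ) :=
  {S | S ∈ cfC R cl ∧ ∀ T ∈ cfC R cl, S ⊆ T → T = S}

/-- A family of sets is incomparable if no member is a strict subset of another. -/
def Incomparable {γ : Type*} (S : Set (Set γ)) : Prop :=
  ∀ S1 ∈ S, ∀ S2 ∈ S, ¬ S1 ⊂ S2

theorem ConflictFree.exists_naive_superset {α : Type*} [Finite α] {R : α → α → Prop} {E : Set α}
    (hE : ConflictFree R E) : ∃ N, Naive R N ∧ E ⊆ N := by
  obtain ⟨N, hEN, hN⟩ := (Set.toFinite {E : Set α | ConflictFree R E}).exists_le_maximal hE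
  exact ⟨N, ⟨hN.prop, fun E' hE' h => (hN.le_of_ge hE' h).antisymm h⟩, hEN⟩

theorem naC_subset_cfC {α γ : Type*} (R : α → α → Prop) (cl : α → γ) : naC R cl ⊆ cfC R cl := by
  rintro _ ⟨E, hE, rfl⟩
  exact ⟨E, hE.1, rfl⟩

theorem exists_superset_mem_naC {α γ : Type*} [Finite α] {R : α → α → Prop} {cl : α → γ}
    {S : Set γ} (hS : S ∈ cfC R cl) : ∃ T ∈ naC R cl, S ⊆ T := by
  obtain ⟨E, hE, rfl⟩ := hS
  obtain ⟨N, hN, hEN⟩ := hE.exists_naive_superset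
  exact ⟨cl '' N, ⟨N, hN, rfl⟩, Set.image_mono hEN⟩

theorem clNaive_subset_naC {α γ : Type*} [Finite α] (R : α → α → Prop) (cl : α → γ) :
    clNaive R cl ⊆ naC R cl := by
  rintro S ⟨hS, hmax⟩
  obtain ⟨T, hT, hST⟩ := exists_superset_mem_naC hS
  exact hmax T (naC_subset_cfC R cl hT) hST ▸ hT

theorem incomparable_clNaive {α γ : Type*} (R : α → α → Prop) (cl : α → γ) :
    Incomparable (clNaive R cl) :=
  fun _ h₁ _ h₂ h => h.ne (h₁.2 _ h₂.1 h.subset).symm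

/-- For every CAF, the inherited naive semantics and the claim-level
naive semantics coincide iff the family `na_c(F)` is incomparable. -/
theorem concurrence_iff_incomparable {α γ : Type*} [Fintype α]
    (R : α → α → Prop) (cl : α → γ) :
    naC R cl = clNaive R cl ↔ Incomparable (naC R cl) := by
  refine ⟨fun h => h ▸ incomparable_clNaive R cl, fun h => Set.Subset.antisymm ?_
    (clNaive_subset_naC R cl)⟩
  refine fun S hS => ⟨naC_subset_cfC R cl hS, fun T hT hST => ?_⟩
  obtain ⟨U, hU, hTU⟩ := exists_superset_mem_naC hT
  have hSU : S = U := eq_of_le_of_not_lt (hST.trans hTU) (h S hS U hU)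
  exact (hTU.trans hSU.ge).antisymm hST
end

section
/- If M ⊆ X is a model of the CNF formula φ, then the set E = M ∪ {x̄ : x ∈ X, x ∉ M} ∪ {φ, a1} is a naive extension (⊆-maximal conflict-free set) of the reduction CAF F_φ. -/
/-- Arguments of the reduction CAF `F_φ` for a CNF formula over atoms `X`
with clause index set `I`: an argument `pos x` for each atom `x`, an argument
`neg x` (i.e. `x̄`) for each atom, an argument `cls i` for each clause,
and the arguments `φ`, `a1`, `a2`. -/
inductive RArg (X I : Type*) where
  | pos : X → RArg X I
  | neg : X → RArg X I
  | cls : I → RArg X I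
  | phi : RArg X I
  | a1 : RArg X I
  | a2 : RArg X I

/-- Claims of the reduction CAF: each atom argument, negated-atom argument,
clause argument and `φ` has its own claim; `a1` and `a2` share the fresh claim `a`. -/
inductive RClaim (X I : Type*) where
  | pos : X → RClaim X I
  | neg : X → RClaim X I
  | cls : I → RClaim X I
  | phi : RClaim X I
  | a : RClaim X I

/-- The claim function of the reduction CAF. -/
def rcl {X I : Type*} : RArg X I → RClaim X I
  | .pos x => .pos x
  | .neg x => .neg x
  | .cls i => .cls i
  | .phi => .phi
  | .a1 => .a
  | .a2 => .a

/-- The attack relation of the reduction CAF, where clause `i` has positive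
literals `P i` and negative literals `N i`:  `x` attacks clause `i` if `x ∈ P i`,
`x̄` attacks clause `i` if `¬x ∈ cl_i` (i.e. `x ∈ N i`), `x` and `x̄` attack each
other, every clause attacks `φ`, and `φ` attacks `a2`. -/
def rAtt {X I : Type*} (P N : I → Set X) : RArg X I → RArg X I → Prop := fun u v =>
  match u, v with
  | .pos x, .cls i => x ∈ P i
  | .neg x, .cls i => x ∈ N i
  | .pos x, .neg y => x = y
  | .neg x, .pos y => x = y
  | .cls _, .phi => True
  | .phi, .a2 => True
  | _, _ => False

/-- No clause contains both a literal and its negation. -/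
def NonTaut {X I : Type*} (P N : I → Set X) : Prop :=
  ∀ i : I, ∀ x : X, ¬ (x ∈ P i ∧ x ∈ N i)

/-- `M ⊆ X` is a model of the CNF formula: every clause contains a positive
literal in `M` or a negative literal whose atom is not in `M`. -/
def IsModel {X I : Type*} (P N : I → Set X) (M : Set X) : Prop :=
  ∀ i : I, (∃ x ∈ P i, x ∈ M) ∨ (∃ x ∈ N i, x ∉ M)

/-- The formula is satisfiable if it has a model. -/
def Satisfiable {X I : Type*} (P N : I → Set X) : Prop :=
  ∃ M : Set X, IsModel P N M

/-- The naive extension `E = M ∪ {x̄ : x ∉ M} ∪ {φ, a1}` built from a model `M`. -/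
def Ephi {X I : Type*} (M : Set X) : Set (RArg X I) :=
  (RArg.pos '' M) ∪ (RArg.neg '' Mᶜ) ∪ {RArg.phi, RArg.a1}

/-- The naive extension `E' = M ∪ {x̄ : x ∉ M} ∪ {a1, a2}` built from a model `M`. -/
def Ea {X I : Type*} (M : Set X) : Set (RArg X I) :=
  (RArg.pos '' M) ∪ (RArg.neg '' Mᶜ) ∪ {RArg.a1, RArg.a2}

theorem mem_Ephi_pos {X I : Type*} {M : Set X} {x : X} :
    RArg.pos x ∈ Ephi (I := I) M ↔ x ∈ M := by
  simp [Ephi]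

theorem mem_Ephi_neg {X I : Type*} {M : Set X} {x : X} :
    RArg.neg x ∈ Ephi (I := I) M ↔ x ∉ M := by
  simp [Ephi]

theorem cls_notMem_Ephi {X I : Type*} {M : Set X} {i : I} :
    RArg.cls i ∉ Ephi M := by
  simp [Ephi]

theorem phi_mem_Ephi {X I : Type*} {M : Set X} : RArg.phi ∈ Ephi (I := I) M := by
  simp [Ephi]

theorem a1_mem_Ephi {X I : Type*} {M : Set X} : RArg.a1 ∈ Ephi (I := I) M := by
  simp [Ephi]

theorem a2_notMem_Ephi {X I : Type*} {M : Set X} : RArg.a2 ∉ Ephi (I := I) M := by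
  simp [Ephi]

theorem conflictFree_Ephi {X I : Type*} (P N : I → Set X) (M : Set X) :
    ConflictFree (rAtt P N) (Ephi M) := by
  rintro (x | x | i | _ | _ | _) hu (y | y | j | _ | _ | _) hv h <;>
    simp_all [rAtt, mem_Ephi_pos, mem_Ephi_neg, cls_notMem_Ephi, a2_notMem_Ephi]

/-- If `M` is a model of `φ`, then `E = M ∪ {x̄ : x ∉ M} ∪ {φ, a1}`
is a naive extension of the reduction CAF `F_φ`. -/
theorem Ephi_naive {X I : Type*} [Fintype X] [Fintype I]
    (P N : I → Set X) (hNT : NonTaut P N) (M : Set X) (hM : IsModel P N M) :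
    Naive (rAtt P N) (Ephi (I := I) M) := by
  refine ⟨conflictFree_Ephi P N M, fun E' hE' hsub => Set.Subset.antisymm ?_ hsub⟩
  rintro (x | x | i | _ | _ | _) hu
  · rw [mem_Ephi_pos]
    by_contra hx
    exact hE' _ hu _ (hsub (mem_Ephi_neg.2 hx)) rfl
  · rw [mem_Ephi_neg]
    intro hx
    exact hE' _ hu _ (hsub (mem_Ephi_pos.2 hx)) rfl
  · exact (hE' _ hu _ (hsub phi_mem_Ephi) trivial).elim
  · exact phi_mem_Ephi
  · exact a1_mem_Ephi
  · exact (hE' _ (hsub phi_mem_Ephi) _ hu trivial).elim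
end

section
/- If M ⊆ X is a model of the CNF formula φ, then the set E' = M ∪ {x̄ : x ∈ X, x ∉ M} ∪ {a1, a2} is a naive extension (⊆-maximal conflict-free set) of the reduction CAF F_φ. -/
section EaMembership

variable {X I : Type*} {M : Set X}

@[simp] theorem pos_mem_Ea {x : X} : RArg.pos x ∈ Ea (I := I) M ↔ x ∈ M := by simp [Ea]

@[simp] theorem neg_mem_Ea {x : X} : RArg.neg x ∈ Ea (I := I) M ↔ x ∉ M := by simp [Ea]

@[simp] theorem cls_notMem_Ea {i : I} : RArg.cls i ∉ Ea M := by simp [Ea]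

@[simp] theorem phi_notMem_Ea : RArg.phi ∉ Ea (I := I) M := by simp [Ea]

@[simp] theorem a1_mem_Ea : RArg.a1 ∈ Ea (I := I) M := by simp [Ea]

@[simp] theorem a2_mem_Ea : RArg.a2 ∈ Ea (I := I) M := by simp [Ea]

end EaMembership

theorem conflictFree_Ea {X I : Type*} (P N : I → Set X) (M : Set X) :
    ConflictFree (rAtt P N) (Ea (I := I) M) := by
  rintro (x | x | i | _ | _ | _) hu (y | y | j | _ | _ | _) hv <;> simp_all [rAtt] <;>
    rintro rfl <;> contradiction

/-- Every argument outside `Ea M` is in conflict with a member of `Ea M`. -/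
theorem exists_conflict_of_notMem_Ea {X I : Type*} {P N : I → Set X} {M : Set X}
    (hM : IsModel P N M) {u : RArg X I} (hu : u ∉ Ea M) :
    ∃ v ∈ Ea M, rAtt P N v u ∨ rAtt P N u v := by
  rcases u with x | x | i | _ | _ | _
  · exact ⟨.neg x, by simpa using hu, .inl rfl⟩
  · exact ⟨.pos x, by simpa using hu, .inl rfl⟩
  · rcases hM i with ⟨x, hx, hxM⟩ | ⟨x, hx, hxM⟩
    · exact ⟨.pos x, by simpa using hxM, .inl hx⟩
    · exact ⟨.neg x, by simpa using hxM, .inl hx⟩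
  · exact ⟨.a2, a2_mem_Ea, .inr trivial⟩
  · exact absurd a1_mem_Ea hu
  · exact absurd a2_mem_Ea hu

/-- If `M` is a model of `φ`, then `E' = M ∪ {x̄ : x ∉ M} ∪ {a1, a2}`
is a naive extension of the reduction CAF `F_φ`. -/
theorem Ea_naive {X I : Type*} [Fintype X] [Fintype I]
    (P N : I → Set X) (hNT : NonTaut P N) (M : Set X) (hM : IsModel P N M) :
    Naive (rAtt P N) (Ea (I := I) M) := by
  refine ⟨conflictFree_Ea P N M, fun E' hE' hsub => Set.Subset.antisymm (fun u hu => ?_) hsub⟩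
  by_contra hnot
  obtain ⟨v, hv, hvu | huv⟩ := exists_conflict_of_notMem_Ea hM hnot
  · exact hE' v (hsub hv) u hu hvu
  · exact hE' u hu v (hsub hv) huv
end

section
/- If the CNF formula φ is satisfiable, then the family na_c(F_φ) of claim-sets of naive extensions of the reduction CAF F_φ is not incomparable: there exist naive extensions E and E' of F_φ with cl(E') ⊊ cl(E). Consequently na_c(F_φ) ≠ cl-naive(F_φ). -/
theorem ConflictFree.naive {α : Type*} {R : α → α → Prop} {E : Set α}
    (hE : ConflictFree R E) (h : ∀ u, u ∉ E → ∃ v ∈ E, R u v ∨ R v u) : Naive R E := by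
  refine ⟨hE, fun E' hE' hsub => Set.Subset.antisymm (fun u hu => ?_) hsub⟩
  by_contra hn
  obtain ⟨v, hv, huv | hvu⟩ := h u hn
  · exact hE' u hu v (hsub hv) huv
  · exact hE' v (hsub hv) u hu hvu

theorem naive_Ephi {X I : Type*} (P N : I → Set X) (M : Set X) :
    Naive (rAtt P N) (Ephi M) := by
  refine ConflictFree.naive ?_ ?_
  · rintro (x | x | i | _ | _ | _) hu (y | y | j | _ | _ | _) hv <;>
      simp_all [Ephi, rAtt] <;> rintro rfl <;> contradiction
  · rintro (x | x | i | _ | _ | _) hu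
    · exact ⟨.neg x, by simp_all [Ephi], by simp [rAtt]⟩
    · exact ⟨.pos x, by simp_all [Ephi], by simp [rAtt]⟩
    · exact ⟨.phi, by simp [Ephi], by simp [rAtt]⟩
    · simp [Ephi] at hu
    · simp [Ephi] at hu
    · exact ⟨.phi, by simp [Ephi], by simp [rAtt]⟩

theorem IsModel.naive_Ea {X I : Type*} {P N : I → Set X} {M : Set X}
    (hM : IsModel P N M) : Naive (rAtt P N) (Ea M) := by
  refine ConflictFree.naive ?_ ?_
  · rintro (x | x | i | _ | _ | _) hu (y | y | j | _ | _ | _) hv <;>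
      simp_all [Ea, rAtt] <;> rintro rfl <;> contradiction
  · rintro (x | x | i | _ | _ | _) hu
    · exact ⟨.neg x, by simp_all [Ea], by simp [rAtt]⟩
    · exact ⟨.pos x, by simp_all [Ea], by simp [rAtt]⟩
    · obtain ⟨x, hx, hxM⟩ | ⟨x, hx, hxM⟩ := hM i
      · exact ⟨.pos x, by simp_all [Ea], Or.inr hx⟩
      · exact ⟨.neg x, by simp_all [Ea], Or.inr hx⟩
    · exact ⟨.a2, by simp [Ea], by simp [rAtt]⟩
    · simp [Ea] at hu
    · simp [Ea] at hu

theorem rcl_image_Ea_ssubset {X I : Type*} (M : Set X) :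
    rcl '' (Ea M : Set (RArg X I)) ⊂ rcl '' (Ephi M : Set (RArg X I)) := by
  refine Set.ssubset_iff_exists.2 ⟨?_, .phi, ⟨.phi, by simp [Ephi], rfl⟩, ?_⟩
  · rintro _ ⟨x | x | i | _ | _ | _, hu, rfl⟩
    · exact ⟨.pos x, by simp_all [Ea, Ephi], rfl⟩
    · exact ⟨.neg x, by simp_all [Ea, Ephi], rfl⟩
    · simp [Ea] at hu
    · simp [Ea] at hu
    · exact ⟨.a1, by simp [Ephi], rfl⟩
    · exact ⟨.a1, by simp [Ephi], rfl⟩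
  · rintro ⟨x | x | i | _ | _ | _, hu, h⟩ <;> simp_all [Ea, rcl]

/-- If `φ` is satisfiable, then `na_c(F_φ)` is not incomparable:
there are naive extensions `E`, `E'` with `cl(E') ⊊ cl(E)`; consequently
`na_c(F_φ) ≠ cl-naive(F_φ)`. -/
theorem satisfiable_not_concurrent {X I : Type*} [Fintype X] [Fintype I]
    (P N : I → Set X) (hNT : NonTaut P N) (hSat : Satisfiable P N) :
    (∃ E E' : Set (RArg X I), Naive (rAtt P N) E ∧ Naive (rAtt P N) E' ∧
      rcl '' E' ⊂ rcl '' E) ∧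
    ¬ Incomparable (naC (rAtt P N) rcl) ∧
    naC (rAtt P N) rcl ≠ clNaive (rAtt P N) rcl := by
  obtain ⟨M, hM⟩ := hSat
  have hlt := rcl_image_Ea_ssubset (I := I) M
  have hinc : ¬ Incomparable (naC (rAtt P N) rcl) := fun h =>
    h _ ⟨_, hM.naive_Ea, rfl⟩ _ ⟨_, naive_Ephi P N M, rfl⟩ hlt
  exact ⟨⟨_, _, naive_Ephi P N M, hM.naive_Ea, hlt⟩, hinc,
    fun h => hinc (h ▸ incomparable_clNaive _ _)⟩
end

section
/- If E is a naive extension of the reduction CAF F_φ with φ ∈ E, then E contains no clause-argument cl_i, E contains a1 but not a2, and for each atom x ∈ X exactly one of x and x̄ belongs to E; consequently cl(E) = {φ, a} ∪ X' ∪ {x̄ : x ∈ X, x ∉ X'} for some subset X' ⊆ X. -/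
/-- A naive set contains every argument that is in no conflict with itself or with the set. -/
theorem Naive.mem_of_forall_not {α : Type*} {R : α → α → Prop} {E : Set α} (hE : Naive R E)
    {a : α} (haa : ¬ R a a) (hout : ∀ b ∈ E, ¬ R a b) (hin : ∀ b ∈ E, ¬ R b a) : a ∈ E := by
  have hcf : ConflictFree R (insert a E) := by
    rintro b (rfl | hb) c (rfl | hc)
    · exact haa
    · exact hout c hc
    · exact hin b hb
    · exact hE.1 b hb c hc
  rw [← hE.2 _ hcf (Set.subset_insert a E)]
  exact Set.mem_insert a E

/-- If `E` is a naive extension of `F_φ` with `φ ∈ E`, then `E`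
contains no clause-argument, contains `a1` but not `a2`, contains exactly one of
`x` and `x̄` for each atom `x`; consequently
`cl(E) = {φ, a} ∪ X' ∪ {x̄ : x ∉ X'}` for some `X' ⊆ X`. -/
theorem naive_with_phi {X I : Type*} [Fintype X] [Fintype I]
    (P N : I → Set X) (hNT : NonTaut P N)
    (E : Set (RArg X I)) (hE : Naive (rAtt P N) E) (hphi : RArg.phi ∈ E) :
    (∀ i : I, RArg.cls i ∉ E) ∧ RArg.a1 ∈ E ∧ RArg.a2 ∉ E ∧
    (∀ x : X, Xor' (RArg.pos x ∈ E) (RArg.neg x ∈ E)) ∧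
    (∃ X' : Set X,
      rcl '' E = {RClaim.phi, RClaim.a} ∪ (RClaim.pos '' X') ∪ (RClaim.neg '' X'ᶜ)) := by
  have hcls : ∀ i : I, RArg.cls i ∉ E := fun i hi => hE.1 _ hi _ hphi trivial
  have ha1 : RArg.a1 ∈ E := by
    refine hE.mem_of_forall_not id (fun b _ => ?_) (fun b _ => ?_) <;> cases b <;> exact id
  have ha2 : RArg.a2 ∉ E := fun h => hE.1 _ hphi _ h trivial
  have hnot : ∀ x : X, RArg.neg x ∈ E ↔ RArg.pos x ∉ E := by
    refine fun x => ⟨fun hn hp => hE.1 _ hp _ hn rfl, fun hp => ?_⟩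
    refine hE.mem_of_forall_not id (fun b hb hR => ?_) (fun b hb hR => ?_)
    · cases b with
      | pos y => cases hR; exact hp hb
      | cls i => exact hcls i hb
      | _ => exact hR
    · cases b with
      | pos y => cases hR; exact hp hb
      | _ => exact hR
  refine ⟨hcls, ha1, ha2, fun x => ?_, {x | RArg.pos x ∈ E}, ?_⟩
  · rw [hnot]
    exact xor_not_right.2 Iff.rfl
  · ext c
    constructor
    · rintro ⟨u, hu, rfl⟩
      cases u with
      | pos x => exact Or.inl (Or.inr ⟨x, hu, rfl⟩)
      | neg x => exact Or.inr ⟨x, (hnot x).1 hu, rfl⟩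
      | cls i => exact absurd hu (hcls i)
      | phi => exact Or.inl (Or.inl (Or.inl rfl))
      | a1 => exact Or.inl (Or.inl (Or.inr rfl))
      | a2 => exact absurd hu ha2
    · rintro (((rfl | rfl) | ⟨x, hx, rfl⟩) | ⟨x, hx, rfl⟩)
      · exact ⟨_, hphi, rfl⟩
      · exact ⟨_, ha1, rfl⟩
      · exact ⟨_, hx, rfl⟩
      · exact ⟨_, (hnot x).2 hx, rfl⟩
end

section
/- If E and E' are naive extensions of the reduction CAF F_φ with φ ∈ E and φ ∈ E', then cl(E') is not a strict subset of cl(E). -/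
/-- Conflict-free sets containing `φ` omit `a2`, so inclusion of their claims
lifts to inclusion of the sets themselves. -/
theorem ConflictFree.subset_of_rcl_image_subset {X I : Type*} {P N : I → Set X}
    {E E' : Set (RArg X I)} (hE : ConflictFree (rAtt P N) E)
    (hE' : ConflictFree (rAtt P N) E') (hphi : RArg.phi ∈ E) (hphi' : RArg.phi ∈ E')
    (h : rcl '' E' ⊆ rcl '' E) : E' ⊆ E := by
  intro u hu
  obtain ⟨v, hv, huv⟩ := h ⟨u, hu, rfl⟩
  have hu2 : u ≠ RArg.a2 := by
    rintro rfl
    exact hE' _ hphi' _ hu trivial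
  have hv2 : v ≠ RArg.a2 := by
    rintro rfl
    exact hE _ hphi _ hv trivial
  cases u <;> cases v <;> simp_all [rcl]

/-- If `E` and `E'` are naive extensions of `F_φ` with `φ ∈ E` and
`φ ∈ E'`, then `cl(E')` is not a strict subset of `cl(E)`. -/
theorem no_strict_subset_both_phi {X I : Type*} [Fintype X] [Fintype I]
    (P N : I → Set X) (hNT : NonTaut P N)
    (E E' : Set (RArg X I)) (hE : Naive (rAtt P N) E) (hE' : Naive (rAtt P N) E')
    (hphi : RArg.phi ∈ E) (hphi' : RArg.phi ∈ E') :
    ¬ rcl '' E' ⊂ rcl '' E := by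
  intro h
  have hsub := hE.1.subset_of_rcl_image_subset hE'.1 hphi hphi' h.subset
  exact h.ne (congrArg (rcl '' ·) (hE'.2 E hE.1 hsub).symm)
end
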